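/- arXiv:1508.03691 — 7 statements merged into one kernel-verified Lean document; each statement's English description precedes it below -/
import Mathlib

section
/- Let C be a finite category. If w : ob C → ℚ is a weighting on C and v : ob C → ℚ is a coweighting on C, then ∑_{a ∈ ob C} w(a) = ∑_{a ∈ ob C} v(a). -/
open CategoryTheory

/-- If `w` is a weighting and `v` a coweighting on a finite
category `C`, then their total sums agree. -/
theorem weighting_sum_eq_coweighting_sum
    (C : Type*) [Category C] [Fintype C] [∀ a b : C, Fintype (a ⟶ b)]
    (w v : C → ℚ)
    (hw : ∀ a : C, ∑ b : C, (Fintype.card (a ⟶ b) : ℚ) * w b = 1)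
    (hv : ∀ b : C, ∑ a : C, v a * (Fintype.card (a ⟶ b) : ℚ) = 1) :
    ∑ a : C, w a = ∑ a : C, v a := by
  calc ∑ b : C, w b
      = ∑ b : C, (∑ a : C, v a * (Fintype.card (a ⟶ b) : ℚ)) * w b := by simp [hv]
    _ = ∑ a : C, v a * ∑ b : C, (Fintype.card (a ⟶ b) : ℚ) * w b := by
      simp only [Finset.sum_mul, Finset.mul_sum, mul_assoc]
      exact Finset.sum_comm
    _ = ∑ a : C, v a := by simp [hw]
end

section
/- Let C be a finite category admitting a coweighting. Then any two weightings w and w' on C have the same total sum: ∑_{a ∈ ob C} w(a) = ∑_{a ∈ ob C} w'(a). -/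
open CategoryTheory

/-- The total sum of a weighting of a matrix equals the total sum of any coweighting. -/
theorem sum_weighting_eq_sum_coweighting {ι R : Type*} [Fintype ι] [CommSemiring R]
    (Z : ι → ι → R) (v w : ι → R) (hv : ∀ b, ∑ a, v a * Z a b = 1)
    (hw : ∀ a, ∑ b, Z a b * w b = 1) : ∑ b, w b = ∑ a, v a := by
  calc ∑ b, w b = ∑ b, (∑ a, v a * Z a b) * w b := by simp only [hv, one_mul]
    _ = ∑ a, v a * ∑ b, Z a b * w b := by
      simp only [Finset.sum_mul, Finset.mul_sum, mul_assoc]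
      exact Finset.sum_comm
    _ = ∑ a, v a := by simp only [hw, mul_one]

/-- If a finite category admits a coweighting, then any two
weightings have the same total sum. -/
theorem weightings_sum_unique
    (C : Type*) [Category C] [Fintype C] [∀ a b : C, Fintype (a ⟶ b)]
    (v : C → ℚ)
    (hv : ∀ b : C, ∑ a : C, v a * (Fintype.card (a ⟶ b) : ℚ) = 1)
    (w w' : C → ℚ)
    (hw : ∀ a : C, ∑ b : C, (Fintype.card (a ⟶ b) : ℚ) * w b = 1)
    (hw' : ∀ a : C, ∑ b : C, (Fintype.card (a ⟶ b) : ℚ) * w' b = 1) :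
    ∑ a : C, w a = ∑ a : C, w' a := by
  exact (sum_weighting_eq_sum_coweighting _ v w hv hw).trans
    (sum_weighting_eq_sum_coweighting _ v w' hv hw').symm
end

section
/- Every finite acyclic category admits a weighting and a coweighting; that is, every finite acyclic category has Euler characteristic. -/
open CategoryTheory

/-- A unitriangular linear system, indexed by a finite type and triangular with respect to a strict
order `r`, has a solution for every right-hand side. -/
theorem exists_sum_mul_eq_of_unitriangular {ι R : Type*} [Fintype ι] [Ring R]
    (r : ι → ι → Prop) [IsTrans ι r] [Std.Irrefl r] (M : ι → ι → R)
    (hdiag : ∀ i, M i i = 1) (hoff : ∀ i j, j ≠ i → ¬ r j i → M i j = 0) (c : ι → R) :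
    ∃ w : ι → R, ∀ i, ∑ j, M i j * w j = c i := by
  classical
  have wf : WellFounded r := Finite.wellFounded_of_trans_of_irrefl r
  let F : ∀ i, (∀ j, r j i → R) → R :=
    fun i f => c i - ∑ j, if h : r j i then M i j * f j h else 0
  refine ⟨wf.fix F, fun i => ?_⟩
  have key : wf.fix F i = c i - ∑ j, if r j i then M i j * wf.fix F j else 0 := by
    rw [wf.fix_eq]
    simp [F]
  have hsum : ∑ j, M i j * wf.fix F j =
      ∑ j, ((if j = i then wf.fix F j else 0) + if r j i then M i j * wf.fix F j else 0) := by
    refine Finset.sum_congr rfl fun j _ => ?_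
    by_cases hj : j = i
    · subst hj
      simp [hdiag, Std.Irrefl.irrefl (r := r) j]
    · by_cases hr : r j i
      · simp [hj, hr]
      · simp [hj, hr, hoff i j hj hr]
  rw [hsum, Finset.sum_add_distrib, Finset.sum_ite_eq' Finset.univ i, if_pos (Finset.mem_univ i)]
  nth_rewrite 1 [key]
  exact sub_add_cancel _ _

/-- Every finite acyclic category admits a weighting and a
coweighting, hence has Euler characteristic. -/
theorem acyclic_has_weighting_and_coweighting
    (C : Type*) [Category C] [Fintype C] [∀ a b : C, Fintype (a ⟶ b)]
    (hloop : ∀ x : C, Fintype.card (x ⟶ x) = 1)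
    (hacyclic : ∀ x y : C, Nonempty (x ⟶ y) → Nonempty (y ⟶ x) → x = y) :
    (∃ w : C → ℚ, ∀ a : C, ∑ b : C, (Fintype.card (a ⟶ b) : ℚ) * w b = 1) ∧
    (∃ v : C → ℚ, ∀ b : C, ∑ a : C, v a * (Fintype.card (a ⟶ b) : ℚ) = 1) := by
  let r : C → C → Prop := fun x y => x ≠ y ∧ Nonempty (x ⟶ y)
  have : Std.Irrefl r := ⟨fun _ h => h.1 rfl⟩
  have : IsTrans C r := ⟨by
    rintro x y z ⟨hxy, ⟨f⟩⟩ ⟨-, ⟨g⟩⟩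
    refine ⟨?_, ⟨f ≫ g⟩⟩
    rintro rfl
    exact hxy (hacyclic x y ⟨f⟩ ⟨g⟩)⟩
  have hzero : ∀ x y : C, x ≠ y → ¬ r x y → (Fintype.card (x ⟶ y) : ℚ) = 0 := by
    intro x y hne hr
    have : IsEmpty (x ⟶ y) := not_nonempty_iff.mp fun h => hr ⟨hne, h⟩
    simp
  constructor
  · exact exists_sum_mul_eq_of_unitriangular (Function.swap r)
      (fun a b => (Fintype.card (a ⟶ b) : ℚ)) (fun x => by simp [hloop])
      (fun a b hne hr => hzero a b hne.symm hr) (fun _ => 1)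
  · obtain ⟨v, hv⟩ := exists_sum_mul_eq_of_unitriangular r
      (fun b a => (Fintype.card (a ⟶ b) : ℚ)) (fun x => by simp [hloop])
      (fun b a hne hr => hzero a b hne hr) (fun _ => 1)
    exact ⟨v, fun b => by simpa only [mul_comm] using hv b⟩
end

section
/- Let C be a finite category and let A and B be subsets of ob C that are both filters of C, or both ideals of C. Suppose each of the full subcategories on A, B, A ∩ B, and A ∪ B admits both a weighting and a coweighting, so that each has an Euler characteristic. Then χ(A ∪ B) = χ(A) + χ(B) − χ(A ∩ B). -/
open CategoryTheory
open scoped Classical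

/-- A filter of a category: closed under targets of morphisms out of its members. -/
def CatFilter (C : Type*) [Category C] (S : Set C) : Prop :=
  ∀ x ∈ S, ∀ y : C, Nonempty (x ⟶ y) → y ∈ S

/-- An ideal of a category: closed under sources of morphisms into its members. -/
def CatIdeal (C : Type*) [Category C] (S : Set C) : Prop :=
  ∀ x ∈ S, ∀ y : C, Nonempty (y ⟶ x) → y ∈ S

/-- A weighting on a set `S` of objects of `C`: a function (recorded on all of
`C`, only its values on `S` matter) with `∑_{b ∈ S} |C(a,b)|·w(b) = 1` for all `a ∈ S`. -/
def IsWeightingOn (C : Type*) [Category C] [Fintype C] [∀ a b : C, Fintype (a ⟶ b)]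
    (S : Set C) (w : C → ℚ) : Prop :=
  ∀ a ∈ S, (∑ b : C, if b ∈ S then (Fintype.card (a ⟶ b) : ℚ) * w b else 0) = 1

/-- A coweighting on a set `S` of objects of `C`. -/
def IsCoweightingOn (C : Type*) [Category C] [Fintype C] [∀ a b : C, Fintype (a ⟶ b)]
    (S : Set C) (v : C → ℚ) : Prop :=
  ∀ b ∈ S, (∑ a : C, if a ∈ S then v a * (Fintype.card (a ⟶ b) : ℚ) else 0) = 1

/-- `S` has Euler characteristic `e`: it has both a weighting and a coweighting,
and the total sum of the weighting is `e`. -/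
def HasEulerCharOn (C : Type*) [Category C] [Fintype C] [∀ a b : C, Fintype (a ⟶ b)]
    (S : Set C) (e : ℚ) : Prop :=
  ∃ w v : C → ℚ, IsWeightingOn C S w ∧ IsCoweightingOn C S v ∧
    (∑ b : C, if b ∈ S then w b else 0) = e

/-- The extension by zero of the restriction of `f` to `S`. -/
noncomputable def zeroExt {α : Type*} (S : Set α) (f : α → ℚ) (c : α) : ℚ :=
  if c ∈ S then f c else 0

theorem zeroExt_apply {α : Type*} (S : Set α) (f : α → ℚ) (c : α) :
    zeroExt S f c = if c ∈ S then f c else 0 := rfl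

theorem zeroExt_union_inclExcl {α : Type*} (A B : Set α) (f g h : α → ℚ) :
    zeroExt (A ∪ B) (zeroExt A f + zeroExt B g - zeroExt (A ∩ B) h) =
      zeroExt A f + zeroExt B g - zeroExt (A ∩ B) h := by
  ext c
  by_cases hA : c ∈ A <;> by_cases hB : c ∈ B <;> simp [zeroExt, hA, hB]

theorem CatFilter.inter {C : Type*} [Category C] {A B : Set C}
    (hA : CatFilter C A) (hB : CatFilter C B) : CatFilter C (A ∩ B) :=
  fun x hx y f => ⟨hA x hx.1 y f, hB x hx.2 y f⟩

theorem CatIdeal.inter {C : Type*} [Category C] {A B : Set C}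
    (hA : CatIdeal C A) (hB : CatIdeal C B) : CatIdeal C (A ∩ B) :=
  fun x hx y f => ⟨hA x hx.1 y f, hB x hx.2 y f⟩

section EulerChar

variable {C : Type*} [Category C] [Fintype C] [∀ a b : C, Fintype (a ⟶ b)]

/-- The total of a weighting equals the total of a coweighting. -/
theorem IsWeightingOn.sum_eq_sum_of_isCoweightingOn {S : Set C} {w v : C → ℚ}
    (hw : IsWeightingOn C S w) (hv : IsCoweightingOn C S v) :
    ∑ b : C, zeroExt S w b = ∑ a : C, zeroExt S v a := by
  have h₁ : ∀ b : C, zeroExt S w b =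
      ∑ a : C, if a ∈ S ∧ b ∈ S then v a * (Fintype.card (a ⟶ b) : ℚ) * w b else 0 := by
    intro b
    by_cases hb : b ∈ S
    · simp only [zeroExt, hb, and_true, if_true]
      calc w b = (∑ a : C, if a ∈ S then v a * (Fintype.card (a ⟶ b) : ℚ) else 0) * w b := by
            rw [hv b hb, one_mul]
        _ = _ := by simp only [Finset.sum_mul, ite_mul, zero_mul]
    · simp [zeroExt, hb]
  have h₂ : ∀ a : C, zeroExt S v a =
      ∑ b : C, if a ∈ S ∧ b ∈ S then v a * (Fintype.card (a ⟶ b) : ℚ) * w b else 0 := by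
    intro a
    by_cases ha : a ∈ S
    · simp only [zeroExt, ha, true_and, if_true]
      calc v a = v a * ∑ b : C, if b ∈ S then (Fintype.card (a ⟶ b) : ℚ) * w b else 0 := by
            rw [hw a ha, mul_one]
        _ = _ := by simp only [Finset.mul_sum, mul_ite, mul_zero, mul_assoc]
    · simp [zeroExt, ha]
  simp only [h₁, h₂]
  exact Finset.sum_comm

/-- Extended by zero, a coweighting on a filter solves the coweighting equations of its
indicator function on the whole category. -/
theorem IsCoweightingOn.sum_eq_indicator {S : Set C} {v : C → ℚ}
    (hv : IsCoweightingOn C S v) (hS : CatFilter C S) (b : C) :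
    (∑ a : C, zeroExt S v a * (Fintype.card (a ⟶ b) : ℚ)) =
      if b ∈ S then 1 else 0 := by
  simp only [zeroExt, ite_mul, zero_mul]
  by_cases hb : b ∈ S
  · rw [if_pos hb, hv b hb]
  · rw [if_neg hb]
    refine Finset.sum_eq_zero fun a _ => ?_
    split_ifs with ha
    · have : IsEmpty (a ⟶ b) := ⟨fun f => hb (hS a ha b ⟨f⟩)⟩
      simp
    · rfl

/-- Extended by zero, a weighting on an ideal solves the weighting equations of its
indicator function on the whole category. -/
theorem IsWeightingOn.sum_eq_indicator {S : Set C} {w : C → ℚ}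
    (hw : IsWeightingOn C S w) (hS : CatIdeal C S) (a : C) :
    (∑ b : C, (Fintype.card (a ⟶ b) : ℚ) * zeroExt S w b) =
      if a ∈ S then 1 else 0 := by
  simp only [zeroExt, mul_ite, mul_zero]
  by_cases ha : a ∈ S
  · rw [if_pos ha, hw a ha]
  · rw [if_neg ha]
    refine Finset.sum_eq_zero fun b _ => ?_
    split_ifs with hb
    · have : IsEmpty (a ⟶ b) := ⟨fun f => ha (hS b hb a ⟨f⟩)⟩
      simp
    · rfl

theorem IsCoweightingOn.inclExcl {A B : Set C} {f g h : C → ℚ}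
    (hf : IsCoweightingOn C A f) (hg : IsCoweightingOn C B g) (hh : IsCoweightingOn C (A ∩ B) h)
    (hA : CatFilter C A) (hB : CatFilter C B) :
    IsCoweightingOn C (A ∪ B) (zeroExt A f + zeroExt B g - zeroExt (A ∩ B) h) := by
  intro b hb
  simp only [← ite_zero_mul, ← zeroExt_apply, zeroExt_union_inclExcl]
  simp only [Pi.add_apply, Pi.sub_apply, sub_mul, add_mul, Finset.sum_sub_distrib,
    Finset.sum_add_distrib, hf.sum_eq_indicator hA, hg.sum_eq_indicator hB,
    hh.sum_eq_indicator (hA.inter hB)]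
  by_cases h₁ : b ∈ A <;> by_cases h₂ : b ∈ B <;> simp_all

theorem IsWeightingOn.inclExcl {A B : Set C} {f g h : C → ℚ}
    (hf : IsWeightingOn C A f) (hg : IsWeightingOn C B g) (hh : IsWeightingOn C (A ∩ B) h)
    (hA : CatIdeal C A) (hB : CatIdeal C B) :
    IsWeightingOn C (A ∪ B) (zeroExt A f + zeroExt B g - zeroExt (A ∩ B) h) := by
  intro a ha
  simp only [← mul_ite_zero, ← zeroExt_apply, zeroExt_union_inclExcl]
  simp only [Pi.add_apply, Pi.sub_apply, mul_sub, mul_add, Finset.sum_sub_distrib,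
    Finset.sum_add_distrib, hf.sum_eq_indicator hA, hg.sum_eq_indicator hB,
    hh.sum_eq_indicator (hA.inter hB)]
  by_cases h₁ : a ∈ A <;> by_cases h₂ : a ∈ B <;> simp_all

end EulerChar

/-- Inclusion–exclusion for Euler characteristics of filters
(or ideals) of a finite category. -/
theorem eulerChar_inclusion_exclusion
    (C : Type*) [Category C] [Fintype C] [∀ a b : C, Fintype (a ⟶ b)]
    (A B : Set C)
    (hAB : (CatFilter C A ∧ CatFilter C B) ∨ (CatIdeal C A ∧ CatIdeal C B))
    (χA χB χI χU : ℚ)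
    (hA : HasEulerCharOn C A χA) (hB : HasEulerCharOn C B χB)
    (hI : HasEulerCharOn C (A ∩ B) χI) (hU : HasEulerCharOn C (A ∪ B) χU) :
    χU = χA + χB - χI := by
  obtain ⟨wA, vA, hwA, hvA, rfl⟩ := hA
  obtain ⟨wB, vB, hwB, hvB, rfl⟩ := hB
  obtain ⟨wI, vI, hwI, hvI, rfl⟩ := hI
  obtain ⟨wU, vU, hwU, hvU, rfl⟩ := hU
  simp only [← zeroExt_apply]
  rcases hAB with ⟨hA, hB⟩ | ⟨hA, hB⟩
  · rw [hwU.sum_eq_sum_of_isCoweightingOn (hvA.inclExcl hvB hvI hA hB),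
      hwA.sum_eq_sum_of_isCoweightingOn hvA, hwB.sum_eq_sum_of_isCoweightingOn hvB,
      hwI.sum_eq_sum_of_isCoweightingOn hvI, zeroExt_union_inclExcl]
    simp only [Pi.add_apply, Pi.sub_apply, Finset.sum_sub_distrib, Finset.sum_add_distrib]
  · rw [hwU.sum_eq_sum_of_isCoweightingOn hvU,
      ← (hwA.inclExcl hwB hwI hA hB).sum_eq_sum_of_isCoweightingOn hvU, zeroExt_union_inclExcl]
    simp only [Pi.add_apply, Pi.sub_apply, Finset.sum_sub_distrib, Finset.sum_add_distrib]
end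

section
/- Let C be a finite category in which every filter admits both a weighting and a coweighting, so that every filter S has an Euler characteristic χ(S). If ∑_{i=1}^n a_i·1_{A_i} = ∑_{j=1}^m b_j·1_{B_j} as functions ob C → ℚ, where all a_i, b_j ∈ ℚ and all A_i, B_j are filters of C, then ∑_{i=1}^n a_i·χ(A_i) = ∑_{j=1}^m b_j·χ(B_j); that is, the Euler integration ∫_C f dχ := ∑ a_i χ(A_i) of a definable function f = ∑ a_i·1_{A_i} does not depend on the chosen representation of f by incidence functions on filters. -/
open CategoryTheory
open scoped Classical

/-- Restricting a weighting to a filter yields a weighting. -/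
theorem IsWeightingOn.of_univ {C : Type*} [Category C] [Fintype C] [∀ a b : C, Fintype (a ⟶ b)]
    {S : Set C} {w : C → ℚ} (hw : IsWeightingOn C Set.univ w) (hS : CatFilter C S) :
    IsWeightingOn C S w := by
  intro a ha
  rw [← hw a (Set.mem_univ a)]
  refine Finset.sum_congr rfl fun b _ => ?_
  by_cases hb : b ∈ S
  · simp [hb]
  · have : IsEmpty (a ⟶ b) := ⟨fun f => hb (hS a ha b ⟨f⟩)⟩
    simp [hb]

/-- The total weight of a weighting agrees with the total weight of a coweighting. -/
theorem IsWeightingOn.sum_eq_sum_coweighting {C : Type*} [Category C] [Fintype C]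
    [∀ a b : C, Fintype (a ⟶ b)] {S : Set C} {w v : C → ℚ}
    (hw : IsWeightingOn C S w) (hv : IsCoweightingOn C S v) :
    (∑ b : C, if b ∈ S then w b else 0) = ∑ a : C, if a ∈ S then v a else 0 := by
  calc (∑ b : C, if b ∈ S then w b else 0)
      = ∑ b : C, ∑ a : C, if a ∈ S ∧ b ∈ S then
          v a * (Fintype.card (a ⟶ b) : ℚ) * w b else 0 := by
        refine Finset.sum_congr rfl fun b _ => ?_
        by_cases hb : b ∈ S
        · have h := congrArg (· * w b) (hv b hb)
          simp only [Finset.sum_mul, ite_mul, zero_mul, one_mul] at h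
          simp only [hb, and_true, if_true]
          exact h.symm
        · simp [hb]
    _ = ∑ a : C, ∑ b : C, if a ∈ S ∧ b ∈ S then
          v a * (Fintype.card (a ⟶ b) : ℚ) * w b else 0 := Finset.sum_comm
    _ = ∑ a : C, if a ∈ S then v a else 0 := by
        refine Finset.sum_congr rfl fun a _ => ?_
        by_cases ha : a ∈ S
        · have h := congrArg (v a * ·) (hw a ha)
          simp only [Finset.mul_sum, mul_ite, mul_zero, mul_one, ← mul_assoc] at h
          simp only [ha, true_and, if_true]
          exact h
        · simp [ha]

/-- The Euler integration of a definable function does not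
depend on its representation as a linear combination of incidence functions
of filters. -/
theorem euler_integration_well_defined
    (C : Type*) [Category C] [Fintype C] [∀ a b : C, Fintype (a ⟶ b)]
    (χ : Set C → ℚ)
    (hχ : ∀ S : Set C, CatFilter C S →
      ∃ w v : C → ℚ, IsWeightingOn C S w ∧ IsCoweightingOn C S v ∧
        χ S = ∑ b : C, if b ∈ S then w b else 0)
    (n m : ℕ) (a : Fin n → ℚ) (b : Fin m → ℚ)
    (A : Fin n → Set C) (B : Fin m → Set C)
    (hA : ∀ i, CatFilter C (A i)) (hB : ∀ j, CatFilter C (B j))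
    (hfg : ∀ x : C, (∑ i : Fin n, a i * (if x ∈ A i then 1 else 0)) =
                    (∑ j : Fin m, b j * (if x ∈ B j then 1 else 0))) :
    ∑ i : Fin n, a i * χ (A i) = ∑ j : Fin m, b j * χ (B j) := by
  obtain ⟨w, -, hw, -, -⟩ := hχ Set.univ fun _ _ _ _ => Set.mem_univ _
  have hχw : ∀ S : Set C, CatFilter C S → χ S = ∑ x : C, w x * (if x ∈ S then 1 else 0) := by
    intro S hS
    obtain ⟨w', v, hw', hv, h⟩ := hχ S hS
    rw [h, hw'.sum_eq_sum_coweighting hv, ← (hw.of_univ hS).sum_eq_sum_coweighting hv]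
    simp only [mul_ite, mul_one, mul_zero]
  have integral_eq : ∀ (k : ℕ) (c : Fin k → ℚ) (F : Fin k → Set C), (∀ i, CatFilter C (F i)) →
      ∑ i, c i * χ (F i) = ∑ x : C, w x * ∑ i, c i * (if x ∈ F i then 1 else 0) := by
    intro k c F hF
    simp only [hχw _ (hF _), Finset.mul_sum]
    rw [Finset.sum_comm]
    exact Finset.sum_congr rfl fun x _ => Finset.sum_congr rfl fun i _ => mul_left_comm _ _ _
  rw [integral_eq n a A hA, integral_eq m b B hB]
  exact Finset.sum_congr rfl fun x _ => by rw [hfg x]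
end

section
/- Let C be a finite category with a terminal object x, in which every filter admits both a weighting and a coweighting, so that every filter S has an Euler characteristic χ(S). If f : ob C → ℚ is written as f = ∑_{i=1}^n a_i·1_{A_i} with all a_i ∈ ℚ and all A_i filters of C, then ∑_{i=1}^n a_i·χ(A_i) = f(x); that is, the Euler integration of a definable function on C equals its value at the terminal object. -/
open CategoryTheory
open scoped Classical

/-- If every object has exactly one morphism to `x ∈ S`, a coweighting on `S` has total `1`. -/
theorem IsCoweightingOn.sum_eq_one_of_terminal_mem {C : Type*} [Category C] [Fintype C]
    [∀ a b : C, Fintype (a ⟶ b)] {S : Set C} {v : C → ℚ} (hv : IsCoweightingOn C S v)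
    {x : C} (hx : ∀ y : C, Fintype.card (y ⟶ x) = 1) (hxS : x ∈ S) :
    (∑ a : C, if a ∈ S then v a else 0) = 1 := by
  simpa [hx] using hv x hxS

/-- A filter that misses a terminal object is empty. -/
theorem CatFilter.eq_empty_of_terminal_notMem {C : Type*} [Category C]
    [∀ a b : C, Fintype (a ⟶ b)] {S : Set C} (hS : CatFilter C S)
    {x : C} (hx : ∀ y : C, Fintype.card (y ⟶ x) = 1) (hxS : x ∉ S) : S = ∅ := by
  refine Set.eq_empty_of_forall_notMem fun y hy => hxS (hS y hy x ?_)
  exact Fintype.card_pos_iff.mp (by simp [hx y])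

/-- On a finite category with a terminal object `x`, the Euler
integration of a definable function equals its value at `x`. -/
theorem euler_integration_eq_value_at_terminal
    (C : Type*) [Category C] [Fintype C] [∀ a b : C, Fintype (a ⟶ b)]
    (x : C) (hx : ∀ y : C, Fintype.card (y ⟶ x) = 1)
    (χ : Set C → ℚ)
    (hχ : ∀ S : Set C, CatFilter C S →
      ∃ w v : C → ℚ, IsWeightingOn C S w ∧ IsCoweightingOn C S v ∧
        χ S = ∑ b : C, if b ∈ S then w b else 0)
    (f : C → ℚ) (n : ℕ) (a : Fin n → ℚ) (A : Fin n → Set C)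
    (hA : ∀ i, CatFilter C (A i))
    (hf : ∀ y : C, f y = ∑ i : Fin n, a i * (if y ∈ A i then 1 else 0)) :
    ∑ i : Fin n, a i * χ (A i) = f x := by
  rw [hf x]
  refine Finset.sum_congr rfl fun i _ => congrArg (a i * ·) ?_
  obtain ⟨w, v, hw, hv, h⟩ := hχ (A i) (hA i)
  rw [h]
  by_cases hxA : x ∈ A i
  · rw [if_pos hxA, hw.sum_eq_sum_coweighting hv, hv.sum_eq_one_of_terminal_mem hx hxA]
  · simp [(hA i).eq_empty_of_terminal_notMem hx hxA]
end

section
/- Let C be a finite category in which every full subcategory admits both a weighting and a coweighting (so every set S of objects has an Euler characteristic χ(S)), and suppose ob C = A ∪ B where A and B are both filters of C or both ideals of C. For each X ∈ {ob C, A, B, A ∩ B}, let I_X be a ℚ-linear map from functions ob C → ℚ to ℚ such that I_X(1_T) = χ(T) for every filter T of the full subcategory on X. Then for every definable function f : ob C → ℚ, I_{ob C}(f) = I_A(f·1_A) + I_B(f·1_B) − I_{A∩B}(f·1_{A∩B}); that is, the Euler integration of f over C equals the sum of its Euler integrations over A and over B minus its Euler integration over A ∩ B. -/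
open CategoryTheory
open scoped Classical

/-- A filter of the full subcategory of `C` on a set `X` of objects: a subset
`T ⊆ X` closed in `X` under targets of morphisms out of members of `T`. -/
def CatFilterIn (C : Type*) [Category C] (X T : Set C) : Prop :=
  T ⊆ X ∧ ∀ x ∈ T, ∀ y ∈ X, Nonempty (x ⟶ y) → y ∈ T

/-- A function on objects is definable if it takes equal values on reflexible pairs. -/
def Definable (C : Type*) [Category C] (f : C → ℚ) : Prop :=
  ∀ x y : C, Nonempty (x ⟶ y) → Nonempty (y ⟶ x) → f x = f y

/-- The clipping of `f` to a set `S` of objects. -/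
noncomputable def clip {C : Type*} (f : C → ℚ) (S : Set C) : C → ℚ :=
  fun x => if x ∈ S then f x else 0

/-- Inclusion–exclusion for coweightings on two filters of their union. -/
theorem IsCoweightingOn.union {C : Type*} [Category C] [Fintype C]
    [∀ a b : C, Fintype (a ⟶ b)] {P Q U R : Set C} {p q r : C → ℚ}
    (hU : U = P ∪ Q) (hR : R = P ∩ Q)
    (hP : CatFilterIn C U P) (hQ : CatFilterIn C U Q)
    (hp : IsCoweightingOn C P p) (hq : IsCoweightingOn C Q q)
    (hr : IsCoweightingOn C R r) :
    IsCoweightingOn C U (clip p P + clip q Q - clip r R) := by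
  intro b hb
  have hsplit : (∑ a : C, if a ∈ U then
        (clip p P + clip q Q - clip r R) a * (Fintype.card (a ⟶ b) : ℚ) else 0)
      = (∑ a : C, if a ∈ P then p a * (Fintype.card (a ⟶ b) : ℚ) else 0)
        + (∑ a : C, if a ∈ Q then q a * (Fintype.card (a ⟶ b) : ℚ) else 0)
        - ∑ a : C, if a ∈ R then r a * (Fintype.card (a ⟶ b) : ℚ) else 0 := by
    rw [← Finset.sum_add_distrib, ← Finset.sum_sub_distrib]
    refine Finset.sum_congr rfl fun a _ => ?_
    by_cases haP : a ∈ P <;> by_cases haQ : a ∈ Q <;> simp [clip, hU, hR, haP, haQ]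
    ring
  have hzero : ∀ (X : Set C) (u : C → ℚ), (∀ a ∈ X, IsEmpty (a ⟶ b)) →
      (∑ a : C, if a ∈ X then u a * (Fintype.card (a ⟶ b) : ℚ) else 0) = 0 := by
    intro X u h
    refine Finset.sum_eq_zero fun a _ => ?_
    split_ifs with ha
    · have := h a ha
      simp
    · rfl
  rw [hsplit]
  by_cases hbP : b ∈ P <;> by_cases hbQ : b ∈ Q
  · rw [hp b hbP, hq b hbQ, hr b (hR ▸ ⟨hbP, hbQ⟩)]
    norm_num
  · have h : ∀ a ∈ Q, IsEmpty (a ⟶ b) := fun a ha =>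
      not_nonempty_iff.1 fun e => hbQ (hQ.2 a ha b hb e)
    rw [hp b hbP, hzero Q q h, hzero R r fun a ha => h a (hR.subset ha).2]
    norm_num
  · have h : ∀ a ∈ P, IsEmpty (a ⟶ b) := fun a ha =>
      not_nonempty_iff.1 fun e => hbP (hP.2 a ha b hb e)
    rw [hq b hbQ, hzero P p h, hzero R r fun a ha => h a (hR.subset ha).1]
    norm_num
  · exact ((hU.subset hb).elim hbP hbQ).elim

/-- Inclusion–exclusion for weightings on two ideals of their union. -/
theorem IsWeightingOn.union {C : Type*} [Category C] [Fintype C]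
    [∀ a b : C, Fintype (a ⟶ b)] {P Q U R : Set C} {p q r : C → ℚ}
    (hU : U = P ∪ Q) (hR : R = P ∩ Q)
    (hP : ∀ b ∈ P, ∀ a ∈ U, Nonempty (a ⟶ b) → a ∈ P)
    (hQ : ∀ b ∈ Q, ∀ a ∈ U, Nonempty (a ⟶ b) → a ∈ Q)
    (hp : IsWeightingOn C P p) (hq : IsWeightingOn C Q q)
    (hr : IsWeightingOn C R r) :
    IsWeightingOn C U (clip p P + clip q Q - clip r R) := by
  intro a ha
  have hsplit : (∑ b : C, if b ∈ U then (Fintype.card (a ⟶ b) : ℚ) *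
        (clip p P + clip q Q - clip r R) b else 0)
      = (∑ b : C, if b ∈ P then (Fintype.card (a ⟶ b) : ℚ) * p b else 0)
        + (∑ b : C, if b ∈ Q then (Fintype.card (a ⟶ b) : ℚ) * q b else 0)
        - ∑ b : C, if b ∈ R then (Fintype.card (a ⟶ b) : ℚ) * r b else 0 := by
    rw [← Finset.sum_add_distrib, ← Finset.sum_sub_distrib]
    refine Finset.sum_congr rfl fun b _ => ?_
    by_cases hbP : b ∈ P <;> by_cases hbQ : b ∈ Q <;> simp [clip, hU, hR, hbP, hbQ]
    ring
  have hzero : ∀ (X : Set C) (u : C → ℚ), (∀ b ∈ X, IsEmpty (a ⟶ b)) →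
      (∑ b : C, if b ∈ X then (Fintype.card (a ⟶ b) : ℚ) * u b else 0) = 0 := by
    intro X u h
    refine Finset.sum_eq_zero fun b _ => ?_
    split_ifs with hb
    · have := h b hb
      simp
    · rfl
  rw [hsplit]
  by_cases haP : a ∈ P <;> by_cases haQ : a ∈ Q
  · rw [hp a haP, hq a haQ, hr a (hR ▸ ⟨haP, haQ⟩)]
    norm_num
  · have h : ∀ b ∈ Q, IsEmpty (a ⟶ b) := fun b hb =>
      not_nonempty_iff.1 fun e => haQ (hQ b hb a ha e)
    rw [hp a haP, hzero Q q h, hzero R r fun b hb => h b (hR.subset hb).2]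
    norm_num
  · have h : ∀ b ∈ P, IsEmpty (a ⟶ b) := fun b hb =>
      not_nonempty_iff.1 fun e => haP (hP b hb a ha e)
    rw [hq a haQ, hzero P p h, hzero R r fun b hb => h b (hR.subset hb).1]
    norm_num
  · exact ((hU.subset ha).elim haP haQ).elim

theorem sum_clip_union {C : Type*} [Fintype C] {P Q U R : Set C} (hU : U = P ∪ Q) (hR : R = P ∩ Q)
    (p q r : C → ℚ) :
    (∑ a : C, if a ∈ U then (clip p P + clip q Q - clip r R) a else 0)
      = (∑ a : C, if a ∈ P then p a else 0) + (∑ a : C, if a ∈ Q then q a else 0)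
        - ∑ a : C, if a ∈ R then r a else 0 := by
  rw [← Finset.sum_add_distrib, ← Finset.sum_sub_distrib]
  refine Finset.sum_congr rfl fun a _ => ?_
  by_cases haP : a ∈ P <;> by_cases haQ : a ∈ Q <;> simp [clip, hU, hR, haP, haQ]

/-- Inclusion–exclusion for the Euler characteristic of a union of two filters or two ideals. -/
theorem euler_char_union {C : Type*} [Category C] [Fintype C] [∀ a b : C, Fintype (a ⟶ b)]
    {χ : Set C → ℚ}
    (hχ : ∀ S : Set C,
      ∃ w v : C → ℚ, IsWeightingOn C S w ∧ IsCoweightingOn C S v ∧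
        χ S = ∑ b : C, if b ∈ S then w b else 0)
    {P Q U R : Set C} (hU : U = P ∪ Q) (hR : R = P ∩ Q)
    (hPQ : (CatFilterIn C U P ∧ CatFilterIn C U Q) ∨
      ((∀ b ∈ P, ∀ a ∈ U, Nonempty (a ⟶ b) → a ∈ P) ∧
        ∀ b ∈ Q, ∀ a ∈ U, Nonempty (a ⟶ b) → a ∈ Q)) :
    χ U = χ P + χ Q - χ R := by
  obtain ⟨w, v, hw, hv, h⟩ := hχ U
  obtain ⟨wP, vP, hwP, hvP, hP⟩ := hχ P
  obtain ⟨wQ, vQ, hwQ, hvQ, hQ⟩ := hχ Q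
  obtain ⟨wR, vR, hwR, hvR, hχR⟩ := hχ R
  rw [h, hP, hQ, hχR]
  rcases hPQ with ⟨fP, fQ⟩ | ⟨iP, iQ⟩
  · rw [hw.sum_eq_sum_coweighting (hvP.union hU hR fP fQ hvQ hvR), sum_clip_union hU hR,
      hwP.sum_eq_sum_coweighting hvP, hwQ.sum_eq_sum_coweighting hvQ,
      hwR.sum_eq_sum_coweighting hvR]
  · rw [hw.sum_eq_sum_coweighting hv,
      ← (hwP.union hU hR iP iQ hwQ hwR).sum_eq_sum_coweighting hv, sum_clip_union hU hR]

/-- A linear functional vanishing on indicators of filters vanishes on definable functions. -/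
theorem Definable.map_eq_zero {C : Type*} [Category C] [Fintype C] {f : C → ℚ}
    (hf : Definable C f) (L : (C → ℚ) →ₗ[ℚ] ℚ)
    (hL : ∀ T : Set C, CatFilter C T → L (fun x => if x ∈ T then 1 else 0) = 0) :
    L f = 0 := by
  let cls : C → Set C := fun x => {y | Nonempty (x ⟶ y) ∧ Nonempty (y ⟶ x)}
  have hcls : ∀ x, L (fun y => if y ∈ cls x then 1 else 0) = 0 := by
    intro x
    obtain ⟨U, hU⟩ : ∃ U : Set C, ∀ y, y ∈ U ↔ Nonempty (x ⟶ y) := ⟨{y | _}, fun _ => Iff.rfl⟩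
    obtain ⟨V, hV⟩ : ∃ V : Set C, ∀ y, y ∈ V ↔ Nonempty (x ⟶ y) ∧ ¬ Nonempty (y ⟶ x) :=
      ⟨{y | _}, fun _ => Iff.rfl⟩
    have hUfil : CatFilter C U := fun y hy z ⟨g⟩ => by
      obtain ⟨e⟩ := (hU y).1 hy
      exact (hU z).2 ⟨e ≫ g⟩
    have hVfil : CatFilter C V := fun y hy z ⟨g⟩ => by
      obtain ⟨⟨e⟩, hn⟩ := (hV y).1 hy
      exact (hV z).2 ⟨⟨e ≫ g⟩, fun ⟨k⟩ => hn ⟨g ≫ k⟩⟩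
    have heq : (fun y => if y ∈ cls x then (1 : ℚ) else 0) =
        (fun y => if y ∈ U then (1 : ℚ) else 0) - fun y => if y ∈ V then (1 : ℚ) else 0 := by
      funext y
      have hy : y ∈ cls x ↔ Nonempty (x ⟶ y) ∧ Nonempty (y ⟶ x) := Iff.rfl
      by_cases hxy : Nonempty (x ⟶ y) <;> by_cases hyx : Nonempty (y ⟶ x) <;>
        simp only [Pi.sub_apply, hy, hU, hV, hxy, hyx] <;> norm_num
    rw [heq, map_sub, hL _ hUfil, hL _ hVfil, sub_zero]
  have hsymm : ∀ x y, y ∈ cls x → cls x = cls y := by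
    rintro x y ⟨⟨e⟩, ⟨g⟩⟩
    ext z
    exact ⟨fun ⟨⟨h⟩, ⟨k⟩⟩ => ⟨⟨g ≫ h⟩, ⟨k ≫ e⟩⟩, fun ⟨⟨h⟩, ⟨k⟩⟩ => ⟨⟨e ≫ h⟩, ⟨k ≫ g⟩⟩⟩
  have hdecomp : f = ∑ x : C, (f x / ((cls x).ncard : ℚ)) •
      fun y => if y ∈ cls x then (1 : ℚ) else 0 := by
    funext y
    have hne : ((cls y).ncard : ℚ) ≠ 0 := by
      have hy : y ∈ cls y := ⟨⟨𝟙 y⟩, ⟨𝟙 y⟩⟩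
      exact_mod_cast (Set.ncard_ne_zero_of_mem hy)
    have hterm : ∀ x : C, (f x / ((cls x).ncard : ℚ)) * (if y ∈ cls x then (1 : ℚ) else 0) =
        if x ∈ cls y then f y / ((cls y).ncard : ℚ) else 0 := by
      intro x
      by_cases h : y ∈ cls x
      · rw [if_pos h, if_pos (show x ∈ cls y from ⟨h.2, h.1⟩), hsymm x y h, hf x y h.1 h.2,
          mul_one]
      · rw [if_neg h, if_neg fun h' : x ∈ cls y => h ⟨h'.2, h'.1⟩, mul_zero]
    simp only [Finset.sum_apply, Pi.smul_apply, smul_eq_mul, hterm]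
    rw [← Finset.sum_filter, Finset.sum_const, nsmul_eq_mul,
      show (Finset.univ.filter fun x => x ∈ cls y).card = (cls y).ncard by
        rw [← Set.ncard_coe_finset]; simp]
    field_simp
  rw [hdecomp, map_sum]
  exact Finset.sum_eq_zero fun x _ => by rw [map_smul, hcls, smul_zero]

/-- Clipping to a fixed set, as a linear map. -/
noncomputable def clipLinearMap {C : Type*} (S : Set C) : (C → ℚ) →ₗ[ℚ] (C → ℚ) where
  toFun f := clip f S
  map_add' f g := by
    funext x
    by_cases h : x ∈ S <;> simp [clip, h]
  map_smul' c f := by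
    funext x
    by_cases h : x ∈ S <;> simp [clip, h]

theorem clip_indicator {C : Type*} {T S U : Set C} (hU : U = T ∩ S) :
    clip (fun x => if x ∈ T then 1 else 0) S = fun x => if x ∈ U then 1 else 0 := by
  funext x
  by_cases h : x ∈ S <;> simp [clip, hU, h]

theorem CatFilter.inter_filterIn {C : Type*} [Category C] {T : Set C} (hT : CatFilter C T)
    (S : Set C) : CatFilterIn C S (T ∩ S) :=
  ⟨Set.inter_subset_right, fun x hx y hy e => ⟨hT x hx.1 y e, hy⟩⟩

/-- Inclusion–exclusion for Euler integration: if
`ob C = A ∪ B` with `A`, `B` both filters or both ideals, then the Euler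
integration of a definable function over `C` is the sum of its integrations
over `A` and `B` minus that over `A ∩ B`. -/
theorem euler_integration_inclusion_exclusion
    (C : Type*) [Category C] [Fintype C] [∀ a b : C, Fintype (a ⟶ b)]
    (χ : Set C → ℚ)
    (hχ : ∀ S : Set C,
      ∃ w v : C → ℚ, IsWeightingOn C S w ∧ IsCoweightingOn C S v ∧
        χ S = ∑ b : C, if b ∈ S then w b else 0)
    (A B : Set C) (hcover : A ∪ B = Set.univ)
    (hAB : (CatFilter C A ∧ CatFilter C B) ∨ (CatIdeal C A ∧ CatIdeal C B))
    (IC IA IB II : (C → ℚ) →ₗ[ℚ] ℚ)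
    (hIC : ∀ T : Set C, CatFilterIn C Set.univ T →
      IC (fun x => if x ∈ T then 1 else 0) = χ T)
    (hIA : ∀ T : Set C, CatFilterIn C A T →
      IA (fun x => if x ∈ T then 1 else 0) = χ T)
    (hIB : ∀ T : Set C, CatFilterIn C B T →
      IB (fun x => if x ∈ T then 1 else 0) = χ T)
    (hII : ∀ T : Set C, CatFilterIn C (A ∩ B) T →
      II (fun x => if x ∈ T then 1 else 0) = χ T)
    (f : C → ℚ) (hf : Definable C f) :
    IC f = IA (clip f A) + IB (clip f B) - II (clip f (A ∩ B)) := by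
  have key := hf.map_eq_zero
    (IC - (IA ∘ₗ clipLinearMap A + IB ∘ₗ clipLinearMap B - II ∘ₗ clipLinearMap (A ∩ B))) ?_
  · exact sub_eq_zero.1 key
  intro T hT
  have hunion : T ∩ A ∪ T ∩ B = T := by
    rw [← Set.inter_union_distrib_left, hcover, Set.inter_univ]
  have hinter : T ∩ A ∩ (T ∩ B) = T ∩ (A ∩ B) := (Set.inter_inter_distrib_left T A B).symm
  have hIE : χ T = χ (T ∩ A) + χ (T ∩ B) - χ (T ∩ (A ∩ B)) := by
    apply euler_char_union hχ hunion.symm hinter.symm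
    refine hAB.imp (fun ⟨hA, hB⟩ => ⟨?_, ?_⟩) (fun ⟨hA, hB⟩ => ⟨?_, ?_⟩)
    · exact ⟨Set.inter_subset_left, fun x hx y hy e => ⟨hy, hA x hx.2 y e⟩⟩
    · exact ⟨Set.inter_subset_left, fun x hx y hy e => ⟨hy, hB x hx.2 y e⟩⟩
    · exact fun b hb a ha e => ⟨ha, hA b hb.2 a e⟩
    · exact fun b hb a ha e => ⟨ha, hB b hb.2 a e⟩
  change IC _ - (IA (clip _ A) + IB (clip _ B) - II (clip _ (A ∩ B))) = 0
  rw [clip_indicator rfl, clip_indicator rfl, clip_indicator rfl,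
    hIC T ⟨Set.subset_univ T, fun x hx y _ e => hT x hx y e⟩, hIA _ (hT.inter_filterIn A),
    hIB _ (hT.inter_filterIn B), hII _ (hT.inter_filterIn (A ∩ B)), hIE, sub_self]
end
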